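/- Let 0 < ε₁ < ε₂ be real numbers and set L = log(2·sinh(ε₂)/sinh(ε₁)). Let λ, α : ℝ → ℍ be geodesics in the hyperbolic plane (isometric embeddings of ℝ into the upper half-plane ℍ with its hyperbolic metric). Let t₀ < t₁ < t₂ be real numbers with t₁ − t₀ ≥ L and t₂ − t₁ ≥ L (so that the points p₀ = λ(t₀), p₁ = λ(t₁), p₂ = λ(t₂) appear in this order along λ, with consecutive distances at least L). If the distance from p₀ to the geodesic α is at most ε₂ and the distance from p₂ to α is at most ε₂, then the distance from p₁ to α is at most ε₁. -/

import Mathlib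

open UpperHalfPlane

/-- The Minkowski form of signature `(1, 2)`, in light-cone coordinates. -/
noncomputable def minkowskiForm (u v : ℝ × ℝ × ℝ) : ℝ :=
  (u.1 * v.2.2 + u.2.2 * v.1) / 2 - u.2.1 * v.2.1

/-- The embedding of the upper half-plane as a sheet of the hyperboloid
`minkowskiForm v v = 1`. -/
noncomputable def toHyperboloid (z : UpperHalfPlane) : ℝ × ℝ × ℝ :=
  ((z.re ^ 2 + z.im ^ 2) / z.im, z.re / z.im, 1 / z.im)

lemma cosh_dist_eq_minkowskiForm (z w : UpperHalfPlane) :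
    Real.cosh (dist z w) = minkowskiForm (toHyperboloid z) (toHyperboloid w) := by
  have hz := z.im_pos.ne'
  have hw := w.im_pos.ne'
  rw [UpperHalfPlane.cosh_dist']
  simp only [minkowskiForm, toHyperboloid]
  field_simp
  ring

lemma minkowskiForm_toHyperboloid_self (z : UpperHalfPlane) :
    minkowskiForm (toHyperboloid z) (toHyperboloid z) = 1 := by
  rw [← cosh_dist_eq_minkowskiForm, dist_self, Real.cosh_zero]

lemma Isometry.minkowskiForm_toHyperboloid {γ : ℝ → UpperHalfPlane} (hγ : Isometry γ) (s t : ℝ) :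
    minkowskiForm (toHyperboloid (γ s)) (toHyperboloid (γ t)) = Real.cosh (t - s) := by
  rw [← cosh_dist_eq_minkowskiForm, hγ.dist_eq, dist_comm, Real.dist_eq, Real.cosh_abs]

lemma minkowskiForm_add_smul (a b : ℝ) (u v w : ℝ × ℝ × ℝ) :
    minkowskiForm (a • u + b • v) w = a * minkowskiForm u w + b * minkowskiForm v w := by
  simp [minkowskiForm]
  ring

lemma minkowskiForm_comm (u v : ℝ × ℝ × ℝ) : minkowskiForm u v = minkowskiForm v u := by
  simp only [minkowskiForm]
  ring

/-- A null vector orthogonal to a timelike vector vanishes. -/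
lemma eq_zero_of_minkowskiForm_eq_zero {u w : ℝ × ℝ × ℝ} (hu : minkowskiForm u u = 1)
    (huw : minkowskiForm u w = 0) (hw : minkowskiForm w w = 0) : w = 0 := by
  obtain ⟨p, q, r⟩ := u
  obtain ⟨x, y, z⟩ := w
  simp only [minkowskiForm] at hu huw hw
  have hr : r ≠ 0 := by
    rintro rfl
    nlinarith [sq_nonneg q]
  have key : (r * y - q * z) ^ 2 + z ^ 2 = 0 := by
    linear_combination (-z ^ 2) * hu + 2 * r * z * huw - r ^ 2 * hw
  have hz : z = 0 := by nlinarith [sq_nonneg (r * y - q * z), sq_nonneg z]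
  subst hz
  have hy : y = 0 := by simpa [hr] using key
  subst hy
  have hx : x = 0 := by simpa [hr] using huw
  simp [hx]

lemma Isometry.sinh_smul_toHyperboloid {γ : ℝ → UpperHalfPlane} (hγ : Isometry γ) (r s t : ℝ) :
    Real.sinh (t - r) • toHyperboloid (γ s) =
      Real.sinh (t - s) • toHyperboloid (γ r) + Real.sinh (s - r) • toHyperboloid (γ t) := by
  have hrr := minkowskiForm_toHyperboloid_self (γ r)
  have hss := minkowskiForm_toHyperboloid_self (γ s)
  have htt := minkowskiForm_toHyperboloid_self (γ t)
  have hrs := hγ.minkowskiForm_toHyperboloid r s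
  have hst := hγ.minkowskiForm_toHyperboloid s t
  have hrt := hγ.minkowskiForm_toHyperboloid r t
  obtain ⟨u, rfl⟩ : ∃ u, s = r + u := ⟨s - r, by ring⟩
  obtain ⟨v, rfl⟩ : ∃ v, t = r + u + v := ⟨t - (r + u), by ring⟩
  simp only [show r + u - r = u by ring, show r + u + v - (r + u) = v by ring,
    show r + u + v - r = u + v by ring] at *
  rw [Real.cosh_add] at hrt
  rw [Real.sinh_add]
  have hu := Real.cosh_sq u
  have hv := Real.cosh_sq v
  generalize toHyperboloid (γ r) = A at *
  generalize toHyperboloid (γ (r + u)) = B at *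
  generalize toHyperboloid (γ (r + u + v)) = C at *
  generalize Real.sinh u = a at *
  generalize Real.cosh u = b at *
  generalize Real.sinh v = c at *
  generalize Real.cosh v = d at *
  rw [← sub_eq_zero]
  set W := (a * d + b * c) • B - (c • A + a • C) with hW
  have hWX : ∀ X, minkowskiForm X W = (a * d + b * c) * minkowskiForm X B
      - c * minkowskiForm X A - a * minkowskiForm X C := by
    intro X
    simp [hW, minkowskiForm]
    ring
  refine eq_zero_of_minkowskiForm_eq_zero hrr ?_ ?_
  · rw [hWX, hrr, hrs, hrt]
    linear_combination c * hu
  · have h1 : minkowskiForm A W = 0 := by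
      rw [hWX, hrr, hrs, hrt]
      linear_combination c * hu
    have h2 : minkowskiForm B W = 0 := by
      rw [hWX, hss, hst, minkowskiForm_comm B A, hrs]
      ring
    have h3 : minkowskiForm C W = 0 := by
      rw [hWX, htt, minkowskiForm_comm C A, minkowskiForm_comm C B, hst, hrt]
      linear_combination a * hv
    rw [hWX, minkowskiForm_comm W A, minkowskiForm_comm W B, minkowskiForm_comm W C, h1, h2, h3]
    ring

lemma Real.exists_mul_cosh_add_mul_sinh_sq_eq {a b : ℝ} (ha : 0 < a) (hab : 0 < a ^ 2 - b ^ 2) :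
    ∃ s, (a * Real.cosh s + b * Real.sinh s) ^ 2 = a ^ 2 - b ^ 2 := by
  set r := √(a ^ 2 - b ^ 2)
  have hr : 0 < r := Real.sqrt_pos.2 hab
  have hr2 : r ^ 2 = a ^ 2 - b ^ 2 := Real.sq_sqrt hab.le
  refine ⟨Real.arsinh (-b / r), ?_⟩
  have hc : Real.cosh (Real.arsinh (-b / r)) = a / r := by
    rw [Real.cosh_arsinh, show 1 + (-b / r) ^ 2 = (a / r) ^ 2 by field_simp; linarith,
      Real.sqrt_sq (by positivity)]
  rw [hc, Real.sinh_arsinh, ← hr2]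
  have h : a * (a / r) + b * (-b / r) = r := by
    field_simp
    linarith
  rw [h]

/-- The hyperbolic sine of the distance to a geodesic is the absolute value of a linear
functional on the hyperboloid. -/
lemma Isometry.exists_sinh_infDist_eq {α : ℝ → UpperHalfPlane} (hα : Isometry α) :
    ∃ n : ℝ × ℝ × ℝ, ∀ z, Real.sinh (Metric.infDist z (Set.range α)) =
      |minkowskiForm n (toHyperboloid z)| := by
  set A := toHyperboloid (α 0) with hA
  have h1 : Real.sinh 1 ≠ 0 := (Real.sinh_pos_iff.2 one_pos).ne'
  obtain ⟨V, hV⟩ : ∃ V, V = (Real.sinh 1)⁻¹ • (toHyperboloid (α 1) - Real.cosh 1 • A) := ⟨_, rfl⟩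
  have hα1 : toHyperboloid (α 1) = Real.cosh 1 • A + Real.sinh 1 • V := by
    rw [hV, smul_inv_smul₀ h1, add_sub_cancel]
  have hαs : ∀ s, toHyperboloid (α s) = Real.cosh s • A + Real.sinh s • V := by
    intro s
    have h := hα.sinh_smul_toHyperboloid 0 s 1
    rw [hα1, sub_zero, sub_zero, Real.sinh_sub] at h
    apply smul_right_injective _ h1
    simp only
    rw [h]
    module
  have hAA : minkowskiForm A A = 1 := minkowskiForm_toHyperboloid_self _
  have hAV : minkowskiForm A V = 0 := by
    have h := hα.minkowskiForm_toHyperboloid 0 1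
    rw [minkowskiForm_comm, hα1, minkowskiForm_add_smul, ← hA, hAA, sub_zero] at h
    rw [minkowskiForm_comm]
    exact (mul_eq_zero.1 (by linarith)).resolve_left h1
  have hVV : minkowskiForm V V = -1 := by
    have h := minkowskiForm_toHyperboloid_self (α 1)
    rw [hα1, minkowskiForm_add_smul, minkowskiForm_comm A, minkowskiForm_comm V,
      minkowskiForm_add_smul, minkowskiForm_add_smul, hAA, hAV, minkowskiForm_comm V A, hAV] at h
    have h2 : Real.sinh 1 ^ 2 * (minkowskiForm V V + 1) = 0 := by
      linear_combination h - Real.cosh_sq 1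
    linarith [(mul_eq_zero.1 h2).resolve_left (pow_ne_zero 2 h1)]
  refine ⟨(A.1 * V.2.1 - A.2.1 * V.1, (A.1 * V.2.2 - A.2.2 * V.1) / 2,
    A.2.1 * V.2.2 - A.2.2 * V.2.1), fun z ↦ ?_⟩
  set n : ℝ × ℝ × ℝ := (A.1 * V.2.1 - A.2.1 * V.1, (A.1 * V.2.2 - A.2.2 * V.1) / 2,
    A.2.1 * V.2.2 - A.2.2 * V.2.1) with hn
  set X := toHyperboloid z
  have hXX : minkowskiForm X X = 1 := minkowskiForm_toHyperboloid_self z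
  have hdist : ∀ s, Real.cosh (dist z (α s)) =
      minkowskiForm A X * Real.cosh s + minkowskiForm V X * Real.sinh s := by
    intro s
    rw [cosh_dist_eq_minkowskiForm, minkowskiForm_comm, hαs, minkowskiForm_add_smul]
    ring
  have hgram : minkowskiForm n X ^ 2 = minkowskiForm A X ^ 2 - minkowskiForm V X ^ 2 - 1 := by
    have hG : minkowskiForm n X ^ 2 =
        minkowskiForm A A * (minkowskiForm V V * minkowskiForm X X - minkowskiForm V X ^ 2)
        - minkowskiForm A V * (minkowskiForm A V * minkowskiForm X X
          - minkowskiForm V X * minkowskiForm A X)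
        + minkowskiForm A X * (minkowskiForm A V * minkowskiForm V X
          - minkowskiForm V V * minkowskiForm A X) := by
      simp only [hn, minkowskiForm]
      ring
    rw [hG, hAA, hAV, hVV, hXX]
    ring
  have hApos : 0 < minkowskiForm A X := by
    rw [hA, ← cosh_dist_eq_minkowskiForm]
    exact Real.cosh_pos _
  have hle : ∀ s, |minkowskiForm n X| ≤ Real.sinh (dist z (α s)) := by
    intro s
    refine abs_le_of_sq_le_sq ?_ (Real.sinh_nonneg_iff.2 dist_nonneg)
    rw [Real.sinh_sq, hdist, hgram]
    nlinarith [sq_nonneg (minkowskiForm A X * Real.sinh s + minkowskiForm V X * Real.cosh s),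
      Real.cosh_sq s]
  obtain ⟨s, hs⟩ := Real.exists_mul_cosh_add_mul_sinh_sq_eq hApos
    (b := minkowskiForm V X) (by nlinarith [sq_nonneg (minkowskiForm n X)])
  apply le_antisymm
  · refine (Real.sinh_le_sinh.2 (Metric.infDist_le_dist_of_mem (Set.mem_range_self s))).trans ?_
    refine le_of_eq ((sq_eq_sq₀ (Real.sinh_nonneg_iff.2 dist_nonneg) (abs_nonneg _)).1 ?_)
    rw [sq_abs, Real.sinh_sq, hdist, hs, hgram]
  · rw [← Real.arsinh_le_arsinh, Real.arsinh_sinh,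
      Metric.le_infDist (Set.range_nonempty α)]
    rintro _ ⟨t, rfl⟩
    rw [← Real.arsinh_sinh (dist z (α t))]
    exact Real.arsinh_le_arsinh.2 (hle t)

lemma Real.sinh_add_sinh_le {L a b : ℝ} (ha : L ≤ a) (hb : L ≤ b) (ha₀ : 0 ≤ a) (hb₀ : 0 ≤ b) :
    Real.sinh a + Real.sinh b ≤ 2 * Real.exp (-L) * Real.sinh (a + b) := by
  wlog hab : a ≤ b generalizing a b
  · rw [add_comm (Real.sinh a), add_comm a]
    exact this hb ha hb₀ ha₀ (le_of_not_ge hab)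
  have hsinh : 0 ≤ Real.sinh (a + b) := Real.sinh_nonneg_iff.2 (by positivity)
  have key : Real.sinh a + Real.sinh b ≤ 2 * Real.exp (-a) * Real.sinh (a + b) := by
    have hx : Real.exp (-a) ≤ 1 := Real.exp_le_one_iff.2 (by linarith)
    have hy : Real.exp (-b) ≤ 1 := Real.exp_le_one_iff.2 (by linarith)
    have hexp : Real.exp a ≤ Real.exp b := Real.exp_le_exp.2 hab
    have hx₀ := Real.exp_pos (-a)
    have hy₀ := Real.exp_pos (-b)
    have hxa : Real.exp (-a) * Real.exp a = 1 := by rw [← Real.exp_add]; simp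
    have hmul : 2 * Real.exp (-a) * Real.sinh (a + b) =
        Real.exp b - Real.exp (-a) ^ 2 * Real.exp (-b) := by
      rw [Real.sinh_eq, neg_add, Real.exp_add, Real.exp_add]
      linear_combination Real.exp b * hxa
    have h1 : Real.exp (-a) ^ 2 * Real.exp (-b) ≤ Real.exp (-b) :=
      mul_le_of_le_one_left hy₀.le (pow_le_one₀ hx₀.le hx)
    have h2 : Real.exp (-a) ^ 2 * Real.exp (-b) ≤ Real.exp (-a) :=
      (mul_le_of_le_one_right (by positivity) hy).trans (pow_le_of_le_one hx₀.le hx two_ne_zero)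
    rw [hmul, Real.sinh_eq, Real.sinh_eq]
    linarith
  refine key.trans ?_
  gcongr

/-- If two points `p₀, p₂` on a geodesic `λ` in the hyperbolic
plane are `ε₂`-close to another geodesic `α`, and `p₁` lies between them at
distance at least `L = log(2 sinh ε₂ / sinh ε₁)` from each, then `p₁` is
`ε₁`-close to `α`. -/
theorem stmt_1 (ε₁ ε₂ : ℝ) (hε₁ : 0 < ε₁) (hε₁₂ : ε₁ < ε₂)
    (L : ℝ) (hL : L = Real.log (2 * Real.sinh ε₂ / Real.sinh ε₁))
    (lam α : ℝ → UpperHalfPlane) (hlam : Isometry lam) (hα : Isometry α)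
    (t₀ t₁ t₂ : ℝ) (h01 : t₀ < t₁) (h12 : t₁ < t₂)
    (hL01 : L ≤ t₁ - t₀) (hL12 : L ≤ t₂ - t₁)
    (hp0 : Metric.infDist (lam t₀) (Set.range α) ≤ ε₂)
    (hp2 : Metric.infDist (lam t₂) (Set.range α) ≤ ε₂) :
    Metric.infDist (lam t₁) (Set.range α) ≤ ε₁ := by
  obtain ⟨n, hn⟩ := hα.exists_sinh_infDist_eq
  rw [← Real.sinh_le_sinh, hn] at hp0 hp2 ⊢
  have hS₁ : 0 < Real.sinh ε₁ := Real.sinh_pos_iff.2 hε₁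
  have hS₂ : 0 < Real.sinh ε₂ := Real.sinh_pos_iff.2 (hε₁.trans hε₁₂)
  have hexp : 2 * Real.exp (-L) * Real.sinh ε₂ = Real.sinh ε₁ := by
    rw [Real.exp_neg, hL, Real.exp_log (by positivity)]
    field_simp
  have hpos : 0 < Real.sinh (t₂ - t₀) := Real.sinh_pos_iff.2 (by linarith)
  have h10 : 0 < Real.sinh (t₁ - t₀) := Real.sinh_pos_iff.2 (by linarith)
  have h21 : 0 < Real.sinh (t₂ - t₁) := Real.sinh_pos_iff.2 (by linarith)
  have hlin : Real.sinh (t₂ - t₀) * minkowskiForm n (toHyperboloid (lam t₁)) =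
      Real.sinh (t₂ - t₁) * minkowskiForm n (toHyperboloid (lam t₀)) +
      Real.sinh (t₁ - t₀) * minkowskiForm n (toHyperboloid (lam t₂)) := by
    have h := congrArg (minkowskiForm · n) (hlam.sinh_smul_toHyperboloid t₀ t₁ t₂)
    simp only [minkowskiForm_add_smul] at h
    rw [minkowskiForm_comm n, minkowskiForm_comm n, minkowskiForm_comm n, ← h]
    simp only [minkowskiForm, Prod.smul_fst, Prod.smul_snd, smul_eq_mul]
    ring
  have hsum := Real.sinh_add_sinh_le hL12 hL01 (sub_pos.2 h12).le (sub_pos.2 h01).le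
  rw [show t₂ - t₁ + (t₁ - t₀) = t₂ - t₀ by ring] at hsum
  refine le_of_mul_le_mul_left ?_ hpos
  calc Real.sinh (t₂ - t₀) * |minkowskiForm n (toHyperboloid (lam t₁))|
      = |Real.sinh (t₂ - t₁) * minkowskiForm n (toHyperboloid (lam t₀)) +
          Real.sinh (t₁ - t₀) * minkowskiForm n (toHyperboloid (lam t₂))| := by
        rw [← hlin, abs_mul, abs_of_pos hpos]
    _ ≤ Real.sinh (t₂ - t₁) * |minkowskiForm n (toHyperboloid (lam t₀))| +
          Real.sinh (t₁ - t₀) * |minkowskiForm n (toHyperboloid (lam t₂))| := by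
        refine (abs_add_le _ _).trans_eq ?_
        rw [abs_mul, abs_mul, abs_of_pos h10, abs_of_pos h21]
    _ ≤ Real.sinh (t₂ - t₁) * Real.sinh ε₂ + Real.sinh (t₁ - t₀) * Real.sinh ε₂ := by
        gcongr
    _ ≤ 2 * Real.exp (-L) * Real.sinh (t₂ - t₀) * Real.sinh ε₂ := by
        rw [← add_mul]
        gcongr
    _ = Real.sinh (t₂ - t₀) * Real.sinh ε₁ := by
        rw [← hexp]
        ring
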